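/- Assume m ≥ 2, n ≥ 2, U ⊆ ℝ^m open and connected, H(u) = H0 + u1·H1 + ⋯ + um·Hm with H0,…,Hm Hermitian n×n complex matrices, and that the spectrum of H(·) is conically connected. Then there exists u0 ∈ U such that H(u0) has n pairwise distinct eigenvalues and such that all nonzero spectral gaps are pairwise distinct: for all j, k, r, s ∈ {1,…,n} with j ≠ k, r ≠ s and (j,k) ≠ (r,s), one has λj(u0) − λk(u0) ≠ λr(u0) − λs(u0). -/

import Mathlib

open scoped BigOperators

/-- The control-affine Hamiltonian `H(u) = H0 + u 1 • H1 + ⋯ + u m • Hm`. -/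
noncomputable def controlHam {n m : ℕ} (H0 : Matrix (Fin n) (Fin n) ℂ)
    (Hc : Fin m → Matrix (Fin n) (Fin n) ℂ) (u : EuclideanSpace ℝ (Fin m)) :
    Matrix (Fin n) (Fin n) ℂ :=
  H0 + ∑ i, (u i : ℂ) • Hc i

/-- `lam u 0 ≤ ⋯ ≤ lam u (n-1)` are the eigenvalues of `H(u)`, repeated according to
their multiplicities, for every `u ∈ U`:  `lam u` is monotone and the characteristic
polynomial of `H(u)` is `∏ j, (X - lam u j)`. -/
def IsOrderedSpectrum {n m : ℕ} (H0 : Matrix (Fin n) (Fin n) ℂ)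
    (Hc : Fin m → Matrix (Fin n) (Fin n) ℂ) (U : Set (EuclideanSpace ℝ (Fin m)))
    (lam : EuclideanSpace ℝ (Fin m) → Fin n → ℝ) : Prop :=
  ∀ u ∈ U, Monotone (lam u) ∧
    (controlHam H0 Hc u).charpoly = ∏ j, (Polynomial.X - Polynomial.C ((lam u j : ℂ)))

/-- The eigenvalue `lam ubar l` is a simple eigenvalue. -/
def SimpleEigAt {n m : ℕ} (lam : EuclideanSpace ℝ (Fin m) → Fin n → ℝ)
    (ubar : EuclideanSpace ℝ (Fin m)) (l : Fin n) : Prop :=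
  ∀ l' : Fin n, lam ubar l' = lam ubar l → l' = l

/-- `ubar ∈ U` is a conical intersection between the (consecutive) eigenvalues
`lam · j` and `lam · k`:  they coincide at `ubar`, the common value is an eigenvalue of
multiplicity two, and the gap opens at least linearly in every direction. -/
def ConicalAt {n m : ℕ} (U : Set (EuclideanSpace ℝ (Fin m)))
    (lam : EuclideanSpace ℝ (Fin m) → Fin n → ℝ) (j k : Fin n)
    (ubar : EuclideanSpace ℝ (Fin m)) : Prop :=
  ubar ∈ U ∧ lam ubar j = lam ubar k ∧
  (∀ l : Fin n, lam ubar l = lam ubar j ↔ (l = j ∨ l = k)) ∧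
  ∃ c > (0 : ℝ), ∀ v : EuclideanSpace ℝ (Fin m), ‖v‖ = 1 →
    ∃ ε > (0 : ℝ), ∀ t : ℝ, 0 < t → t < ε →
      lam (ubar + t • v) k - lam (ubar + t • v) j > c * t

/-- The spectrum is conically connected: every eigenvalue intersection is conical, and
every pair of subsequent eigenvalues admits a conical intersection at which all the
other eigenvalues are simple. -/
def ConicallyConnected {n m : ℕ} (U : Set (EuclideanSpace ℝ (Fin m)))
    (lam : EuclideanSpace ℝ (Fin m) → Fin n → ℝ) : Prop :=
  (∀ ubar ∈ U, ∀ j k : Fin n, (j : ℕ) + 1 = (k : ℕ) → lam ubar j = lam ubar k →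
    ConicalAt U lam j k ubar) ∧
  (∀ j k : Fin n, (j : ℕ) + 1 = (k : ℕ) → ∃ ubar : EuclideanSpace ℝ (Fin m),
    ConicalAt U lam j k ubar ∧ ∀ l : Fin n, l ≠ j → l ≠ k → SimpleEigAt lam ubar l)

theorem cc_quad {n : ℕ} {E : Type*} [NormedAddCommGroup E] [InnerProductSpace ℂ E]
    (A : E →ₗ[ℂ] E) (hA : A.IsSymmetric) (e : OrthonormalBasis (Fin n) ℂ E) (a : Fin n → ℝ)
    (he : ∀ l, A (e l) = (a l : ℂ) • e l) (x : E) :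
    (inner ℂ x (A x)).re = ∑ l, a l * ‖inner ℂ (e l) x‖ ^ 2 := by
  rw [← e.sum_inner_mul_inner x (A x), Complex.re_sum]
  refine Finset.sum_congr rfl fun l _ => ?_
  rw [← hA, he, inner_smul_left, ← inner_conj_symm x (e l)]
  rw [mul_left_comm, mul_comm (starRingEnd ℂ _) (inner ℂ (e l) x), Complex.mul_conj, Complex.conj_ofReal]
  rw [Complex.normSq_eq_norm_sq]
  norm_cast

theorem cc_weyl {n : ℕ} {E : Type*} [NormedAddCommGroup E] [InnerProductSpace ℂ E]
    (A B : E →ₗ[ℂ] E) (hA : A.IsSymmetric) (hB : B.IsSymmetric)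
    (e f : OrthonormalBasis (Fin n) ℂ E) (a b : Fin n → ℝ)
    (he : ∀ l, A (e l) = (a l : ℂ) • e l) (hf : ∀ l, B (f l) = (b l : ℂ) • f l)
    (ha : Monotone a) (hb : Monotone b) (M : ℝ)
    (hM : ∀ x, (inner ℂ x (A x)).re ≤ (inner ℂ x (B x)).re + M * ‖x‖ ^ 2) (i : Fin n) :
    a i ≤ b i + M := by
  have hfin : FiniteDimensional ℂ E := e.toBasis.finiteDimensional_of_finite
  let T : E →ₗ[ℂ] (Fin n → ℂ) := LinearMap.pi fun l =>
    if l < i then (innerSL ℂ (e l)).toLinearMap else if i < l then (innerSL ℂ (f l)).toLinearMap else 0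
  have hT : ¬ Function.Injective T := by
    rw [LinearMap.injective_iff_surjective_of_finrank_eq_finrank]
    · intro hs
      obtain ⟨x, hx⟩ := hs (fun _ => 1)
      have := congrFun hx i
      simp [T] at this
    · rw [Module.finrank_eq_card_basis e.toBasis]; simp
  rw [← LinearMap.ker_eq_bot, Submodule.eq_bot_iff] at hT
  push Not at hT
  obtain ⟨x, hx, hx0⟩ := hT
  rw [LinearMap.mem_ker] at hx
  have hxe : ∀ l, l < i → inner ℂ (e l) x = 0 := by
    intro l hl
    have := congrFun hx l
    simpa [T, hl] using this
  have hxf : ∀ l, i < l → inner ℂ (f l) x = 0 := by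
    intro l hl
    have := congrFun hx l
    simpa [T, hl, hl.not_gt] using this
  have h1 : a i * ‖x‖ ^ 2 ≤ (inner ℂ x (A x)).re := by
    rw [cc_quad A hA e a he, ← e.sum_sq_norm_inner_right, Finset.mul_sum]
    refine Finset.sum_le_sum fun l _ => ?_
    rcases lt_or_ge l i with h | h
    · simp [hxe l h]
    · exact mul_le_mul_of_nonneg_right (ha h) (by positivity)
  have h2 : (inner ℂ x (B x)).re ≤ b i * ‖x‖ ^ 2 := by
    rw [cc_quad B hB f b hf, ← f.sum_sq_norm_inner_right, Finset.mul_sum]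
    refine Finset.sum_le_sum fun l _ => ?_
    rcases lt_or_ge i l with h | h
    · simp [hxf l h]
    · exact mul_le_mul_of_nonneg_right (hb h) (by positivity)
  have h3 := hM x
  have h4 : 0 < ‖x‖ ^ 2 := by positivity
  nlinarith

theorem cc_basis {n : ℕ} (A : Matrix (Fin n) (Fin n) ℂ) (hA : A.IsHermitian) (a : Fin n → ℝ)
    (h : A.charpoly = ∏ j, (Polynomial.X - Polynomial.C ((a j : ℂ)))) :
    ∃ e : OrthonormalBasis (Fin n) ℂ (EuclideanSpace ℂ (Fin n)),
      ∀ l, Matrix.toEuclideanLin A (e l) = (a l : ℂ) • e l := by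
  have h3 := hA.roots_charpoly_eq_eigenvalues
  rw [h, Polynomial.roots_prod _ _ (by simp [Finset.prod_ne_zero_iff, Polynomial.X_sub_C_ne_zero])] at h3
  have h4 : Multiset.map a Finset.univ.val = Multiset.map hA.eigenvalues Finset.univ.val := by
    apply Multiset.map_injective Complex.ofReal_injective
    simpa [Function.comp_def] using h3
  have h5 : ∀ c : ℝ, Nonempty ({i // a i = c} ≃ {i // hA.eigenvalues i = c}) := by
    intro c
    rw [← Fintype.card_eq, Fintype.card_subtype, Fintype.card_subtype]
    have := congrArg (Multiset.count c) h4
    rw [Multiset.count_map, Multiset.count_map] at this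
    simp only [eq_comm (a := c)] at this
    exact this
  have e := fun c => Classical.choice (h5 c)
  let σ := Equiv.ofFiberEquiv e
  have hσ : ∀ i, hA.eigenvalues (σ i) = a i := fun i => Equiv.ofFiberEquiv_map e i
  refine ⟨hA.eigenvectorBasis.reindex σ.symm, fun l => ?_⟩
  have h6 := hA.mulVec_eigenvectorBasis (σ l)
  rw [hσ] at h6
  simp only [OrthonormalBasis.reindex_apply, Equiv.symm_symm]
  ext i
  have := congrFun h6 i
  simpa [Matrix.toLpLin_apply] using this

theorem cc_herm {n m : ℕ} (H0 : Matrix (Fin n) (Fin n) ℂ) (Hc : Fin m → Matrix (Fin n) (Fin n) ℂ)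
    (hH0 : H0.IsHermitian) (hHc : ∀ i, (Hc i).IsHermitian) (u : EuclideanSpace ℝ (Fin m)) :
    (controlHam H0 Hc u).IsHermitian := by
  unfold controlHam Matrix.IsHermitian
  rw [Matrix.conjTranspose_add, Matrix.conjTranspose_sum, hH0.eq]
  congr 1
  refine Finset.sum_congr rfl fun i _ => ?_
  rw [Matrix.conjTranspose_smul, (hHc i).eq]
  simp

theorem cc_lip {n m : ℕ} (U : Set (EuclideanSpace ℝ (Fin m)))
    (H0 : Matrix (Fin n) (Fin n) ℂ) (Hc : Fin m → Matrix (Fin n) (Fin n) ℂ)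
    (hH0 : H0.IsHermitian) (hHc : ∀ i, (Hc i).IsHermitian)
    (lam : EuclideanSpace ℝ (Fin m) → Fin n → ℝ)
    (hlam : IsOrderedSpectrum H0 Hc U lam) :
    ∃ L : ℝ, 0 < L ∧ ∀ u ∈ U, ∀ w ∈ U, ∀ i, lam u i ≤ lam w i + L * ‖u - w‖ := by
  let N : Fin m → ℝ := fun i => ‖LinearMap.toContinuousLinearMap (Matrix.toEuclideanLin (Hc i))‖
  refine ⟨∑ i, N i + 1, ?_, ?_⟩
  · have : 0 ≤ ∑ i, N i := Finset.sum_nonneg fun i _ => norm_nonneg _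
    linarith
  intro u hu w hw i
  obtain ⟨hu1, hu2⟩ := hlam u hu
  obtain ⟨hw1, hw2⟩ := hlam w hw
  have Hu := cc_herm H0 Hc hH0 hHc u
  have Hw := cc_herm H0 Hc hH0 hHc w
  obtain ⟨e, he⟩ := cc_basis _ Hu _ hu2
  obtain ⟨f, hf⟩ := cc_basis _ Hw _ hw2
  refine cc_weyl _ _ (Matrix.isSymmetric_toEuclideanLin_iff.mpr Hu)
    (Matrix.isSymmetric_toEuclideanLin_iff.mpr Hw) e f _ _ he hf hu1 hw1 _ (fun x => ?_) i
  have hd : Matrix.toEuclideanLin (controlHam H0 Hc u) x = Matrix.toEuclideanLin (controlHam H0 Hc w) x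
      + ∑ i, ((u i - w i : ℝ) : ℂ) • Matrix.toEuclideanLin (Hc i) x := by
    have : controlHam H0 Hc u = controlHam H0 Hc w + ∑ i, ((u i - w i : ℝ) : ℂ) • Hc i := by
      unfold controlHam
      rw [add_assoc, ← Finset.sum_add_distrib]
      congr 1
      refine Finset.sum_congr rfl fun i _ => ?_
      rw [← add_smul]; congr 1; push_cast; ring
    rw [this]
    simp [map_add, map_sum]
  rw [hd, inner_add_right, Complex.add_re, inner_sum, Complex.re_sum]
  gcongr
  calc ∑ i, (inner ℂ x (((u i - w i : ℝ) : ℂ) • Matrix.toEuclideanLin (Hc i) x)).re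
      ≤ ∑ i, N i * (‖u - w‖ * ‖x‖ ^ 2) := by
        refine Finset.sum_le_sum fun i _ => ?_
        refine (Complex.re_le_norm _).trans ((norm_inner_le_norm _ _).trans ?_)
        rw [norm_smul]
        have h1 : ‖Matrix.toEuclideanLin (Hc i) x‖ ≤ N i * ‖x‖ :=
          (LinearMap.toContinuousLinearMap (Matrix.toEuclideanLin (Hc i))).le_opNorm x
        have h2 : ‖((u i - w i : ℝ) : ℂ)‖ ≤ ‖u - w‖ := by
          rw [Complex.norm_real]
          exact PiLp.norm_apply_le (u - w) i
        calc ‖x‖ * (‖((u i - w i : ℝ) : ℂ)‖ * ‖Matrix.toEuclideanLin (Hc i) x‖)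
            ≤ ‖x‖ * (‖u - w‖ * (N i * ‖x‖)) := by gcongr
          _ = _ := by ring
    _ = (∑ i, N i) * (‖u - w‖ * ‖x‖ ^ 2) := by rw [Finset.sum_mul]
    _ ≤ (∑ i, N i + 1) * (‖u - w‖ * ‖x‖ ^ 2) := by gcongr; linarith
    _ = _ := by ring

theorem cc_cont {n m : ℕ} (U : Set (EuclideanSpace ℝ (Fin m))) (hU : IsOpen U)
    (lam : EuclideanSpace ℝ (Fin m) → Fin n → ℝ) (L : ℝ)
    (hL : ∀ u ∈ U, ∀ w ∈ U, ∀ i, lam u i ≤ lam w i + L * ‖u - w‖)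
    (p : EuclideanSpace ℝ (Fin m)) (hp : p ∈ U) (i : Fin n) :
    ContinuousAt (fun u => lam u i) p := by
  have h1 : ∀ᶠ u in nhds p, |lam u i - lam p i| ≤ L * ‖u - p‖ := by
    filter_upwards [hU.mem_nhds hp] with u hu
    have a1 := hL u hu p hp i
    have a2 := hL p hp u hu i
    rw [norm_sub_rev] at a2
    rw [abs_le]; constructor <;> linarith
  rw [ContinuousAt, tendsto_iff_dist_tendsto_zero]
  refine squeeze_zero' (Filter.Eventually.of_forall fun u => dist_nonneg) h1 ?_
  have : Continuous fun u : EuclideanSpace ℝ (Fin m) => L * ‖u - p‖ := by fun_prop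
  simpa using this.tendsto p

theorem cc_analytic {n m : ℕ} (U : Set (EuclideanSpace ℝ (Fin m))) (hU : IsOpen U)
    (H0 : Matrix (Fin n) (Fin n) ℂ) (Hc : Fin m → Matrix (Fin n) (Fin n) ℂ)
    (lam : EuclideanSpace ℝ (Fin m) → Fin n → ℝ)
    (hlam : IsOrderedSpectrum H0 Hc U lam)
    (p : EuclideanSpace ℝ (Fin m)) (hp : p ∈ U) (l : Fin n)
    (hc : ContinuousAt (fun u => lam u l) p)
    (hs : SimpleEigAt lam p l) :
    AnalyticAt ℝ (fun u => lam u l) p := by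
  let F : EuclideanSpace ℝ (Fin m) × ℝ → ℝ := fun z =>
    (Matrix.det (fun i j => (if i = j then (z.2 : ℂ) else 0) - controlHam H0 Hc z.1 i j)).re
  have hF : ∀ u ∈ U, ∀ x : ℝ, F (u, x) = ∏ j, (x - lam u j) := by
    intro u hu x
    have h := congrArg (Polynomial.eval (x : ℂ)) (hlam u hu).2
    rw [Matrix.eval_charpoly, Polynomial.eval_prod] at h
    simp only [Polynomial.eval_sub, Polynomial.eval_X, Polynomial.eval_C] at h
    have h2 : F (u, x) = ((Matrix.scalar (Fin n)) (x : ℂ) - controlHam H0 Hc u).det.re := by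
      simp only [F]
      congr 2
    rw [h2, h]
    have : ∏ j, ((x : ℂ) - (lam u j : ℂ)) = ((∏ j, (x - lam u j) : ℝ) : ℂ) := by push_cast; rfl
    rw [this, Complex.ofReal_re]
  have hFd : ContDiff ℝ ⊤ F := by
    have hu : ∀ i : Fin m, ContDiff ℝ ⊤ (fun z : EuclideanSpace ℝ (Fin m) × ℝ => ((z.1 i : ℝ) : ℂ)) := by
      intro i
      have : ContDiff ℝ ⊤ (fun z : EuclideanSpace ℝ (Fin m) × ℝ => z.1 i) :=
        ((EuclideanSpace.proj (𝕜 := ℝ) i).comp (ContinuousLinearMap.fst ℝ _ ℝ)).contDiff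
      exact Complex.ofRealCLM.contDiff.comp this
    have hx : ContDiff ℝ ⊤ (fun z : EuclideanSpace ℝ (Fin m) × ℝ => ((z.2 : ℝ) : ℂ)) :=
      Complex.ofRealCLM.contDiff.comp contDiff_snd
    have hent : ∀ i j, ContDiff ℝ ⊤ (fun z : EuclideanSpace ℝ (Fin m) × ℝ =>
        (if i = j then (z.2 : ℂ) else 0) - controlHam H0 Hc z.1 i j) := by
      intro i j
      refine ContDiff.sub ?_ ?_
      · split_ifs
        · exact hx
        · exact contDiff_const
      · simp only [controlHam, Matrix.add_apply, Matrix.sum_apply, Matrix.smul_apply, smul_eq_mul]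
        refine contDiff_const.add (ContDiff.sum fun k _ => (hu k).mul contDiff_const)
    refine Complex.reCLM.contDiff.comp ?_
    have hdet : ∀ z : EuclideanSpace ℝ (Fin m) × ℝ,
        Matrix.det (fun i j => (if i = j then (z.2 : ℂ) else 0) - controlHam H0 Hc z.1 i j) =
        ∑ σ : Equiv.Perm (Fin n), Equiv.Perm.sign σ • ∏ i,
          ((if σ i = i then (z.2 : ℂ) else 0) - controlHam H0 Hc z.1 (σ i) i) :=
      fun z => Matrix.det_apply _
    simp only [hdet]
    refine ContDiff.sum fun σ _ => ContDiff.const_smul _ (contDiff_prod fun k _ => hent _ _)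
  have hFa : ContDiffAt ℝ ⊤ F (p, lam p l) := hFd.contDiffAt
  have hdiff : DifferentiableAt ℝ F (p, lam p l) := hFa.differentiableAt (by simp)
  have hder : HasDerivAt (fun x => F (p, x)) (∏ j ∈ Finset.univ.erase l, (lam p l - lam p j)) (lam p l) := by
    have h1 : (fun x => F (p, x)) = fun x => (x - lam p l) * ∏ j ∈ Finset.univ.erase l, (x - lam p j) := by
      funext x
      rw [hF p hp, Finset.mul_prod_erase _ (fun j => x - lam p j) (Finset.mem_univ l)]
    rw [h1]
    have h2 : DifferentiableAt ℝ (fun x => ∏ j ∈ Finset.univ.erase l, (x - lam p j)) (lam p l) := by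
      fun_prop
    have := ((hasDerivAt_id (lam p l)).sub_const (lam p l)).mul h2.hasDerivAt
    simp only [id, sub_self, zero_mul, add_zero, one_mul] at this
    exact this
  have hne : (∏ j ∈ Finset.univ.erase l, (lam p l - lam p j)) ≠ 0 := by
    rw [Finset.prod_ne_zero_iff]
    intro j hj h0
    exact (Finset.ne_of_mem_erase hj) (hs j (by linarith))
  have happ : fderiv ℝ F (p, lam p l) (0, 1) = ∏ j ∈ Finset.univ.erase l, (lam p l - lam p j) := by
    have h1 : HasDerivAt (fun x : ℝ => (p, x)) ((0 : EuclideanSpace ℝ (Fin m)), (1 : ℝ)) (lam p l) :=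
      (hasDerivAt_const _ _).prodMk (hasDerivAt_id _)
    exact (hdiff.hasFDerivAt.comp_hasDerivAt (lam p l) h1).unique hder
  have hinv : (fderiv ℝ F (p, lam p l) ∘L .inr ℝ (EuclideanSpace ℝ (Fin m)) ℝ).IsInvertible := by
    refine ⟨ContinuousLinearEquiv.unitsEquivAut ℝ (Units.mk0 _ hne), ?_⟩
    ext
    simp [happ]
  have h1 := hFa.eventually_apply_eq_iff_implicitFunction (by simp) hinv
  have h2 := hFa.contDiffAt_implicitFunction (by simp) hinv
  have h3 : Filter.Tendsto (fun u => (u, lam u l)) (nhds p) (nhds (p, lam p l)) :=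
    (continuousAt_id.prodMk hc)
  have h4 : hFa.implicitFunction (by simp) hinv =ᶠ[nhds p] fun u => lam u l := by
    filter_upwards [h3.eventually h1, hU.mem_nhds hp] with u hu huU
    refine hu.1 ?_
    rw [hF u huU, hF p hp, Finset.prod_eq_zero (Finset.mem_univ l) (by simp),
      Finset.prod_eq_zero (Finset.mem_univ l) (by simp)]
  have h5 : AnalyticAt ℝ (hFa.implicitFunction (by simp) hinv) p := by
    have := contDiffWithinAt_omega_iff_analyticWithinAt.1 (contDiffWithinAt_univ.2 h2)
    rwa [analyticWithinAt_univ] at this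
  exact h5.congr h4

theorem cc_gap {n m : ℕ} (U : Set (EuclideanSpace ℝ (Fin m))) (hU : IsOpen U)
    (lam : EuclideanSpace ℝ (Fin m) → Fin n → ℝ) (L : ℝ) (hL0 : 0 < L)
    (hL : ∀ u ∈ U, ∀ w ∈ U, ∀ i, lam u i ≤ lam w i + L * ‖u - w‖)
    (j k : Fin n) (p : EuclideanSpace ℝ (Fin m)) (h : ConicalAt U lam j k p) :
    ∀ᶠ q in nhds p, q ≠ p → lam q j < lam q k := by
  obtain ⟨hp, -, -, c, hc, hv⟩ := h
  obtain ⟨r0, hr0, hball⟩ := Metric.isOpen_iff.1 hU p hp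
  choose! ε hε hεt using hv
  obtain ⟨T, hT, hTc⟩ := (isCompact_sphere (0 : EuclideanSpace ℝ (Fin m)) 1).elim_nhds_subcover
    (fun v => Metric.ball v (c / (2 * L))) (fun v _ => Metric.ball_mem_nhds v (by positivity))
  have hmem : ∀ t : ℝ, 0 < t → t < r0 → ∀ v : EuclideanSpace ℝ (Fin m), ‖v‖ = 1 → p + t • v ∈ U := by
    intro t ht htr v hv
    apply hball
    simp [norm_smul, hv, abs_of_pos ht, htr]
  have hev : ∀ᶠ q in nhds p, ∀ v ∈ T, ‖q - p‖ < ε v := by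
    rw [Filter.eventually_all_finset]
    intro v hvT
    have h1 : 0 < ε v := hε v (by simpa using hT v hvT)
    filter_upwards [Metric.ball_mem_nhds p h1] with q hq
    simpa [dist_eq_norm] using hq
  filter_upwards [hev, Metric.ball_mem_nhds p hr0] with q hq hqr hne
  set t := ‖q - p‖ with ht
  have ht0 : 0 < t := norm_pos_iff.2 (sub_ne_zero.2 hne)
  have htr : t < r0 := by simpa [dist_eq_norm] using hqr
  set w : EuclideanSpace ℝ (Fin m) := t⁻¹ • (q - p) with hw
  have hw1 : ‖w‖ = 1 := by
    rw [hw, norm_smul, norm_inv, Real.norm_eq_abs, abs_of_pos ht0, ← ht]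
    exact inv_mul_cancel₀ ht0.ne'
  have hqw : p + t • w = q := by
    rw [hw, smul_smul, mul_inv_cancel₀ ht0.ne']; simp
  have := hTc (show w ∈ Metric.sphere _ _ by simpa using hw1)
  simp only [Set.mem_iUnion] at this
  obtain ⟨v, hvT, hwv⟩ := this
  have hv1 : ‖v‖ = 1 := by simpa using hT v hvT
  have h1 := hεt v hv1 t ht0 (hq v hvT)
  have hqU : q ∈ U := hball hqr
  have hvU := hmem t ht0 htr v hv1
  have h2 := hL q hqU _ hvU j
  have h3 := hL _ hvU q hqU k
  have h4 : ‖q - (p + t • v)‖ < t * (c / (2 * L)) := by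
    rw [← hqw]
    have : p + t • w - (p + t • v) = t • (w - v) := by rw [smul_sub]; abel
    rw [this, norm_smul, Real.norm_eq_abs, abs_of_pos ht0]
    rw [Metric.mem_ball, dist_eq_norm] at hwv
    gcongr
  rw [norm_sub_rev] at h3
  have h5 : L * ‖q - (p + t • v)‖ < L * (t * (c / (2 * L))) := by gcongr
  have h6 : L * (t * (c / (2 * L))) = c * t / 2 := by field_simp
  linarith

theorem cc_isolated {n m : ℕ} (U : Set (EuclideanSpace ℝ (Fin m))) (hU : IsOpen U)
    (lam : EuclideanSpace ℝ (Fin m) → Fin n → ℝ) (L : ℝ) (hL0 : 0 < L)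
    (hL : ∀ u ∈ U, ∀ w ∈ U, ∀ i, lam u i ≤ lam w i + L * ‖u - w‖)
    (hmono : ∀ u ∈ U, Monotone (lam u))
    (hcc : ConicallyConnected U lam) (p : EuclideanSpace ℝ (Fin m)) (hp : p ∈ U) :
    ∃ r > 0, Metric.ball p r ⊆ U ∧ ∀ q ∈ Metric.ball p r, q ≠ p → Function.Injective (lam q) := by
  have h1 : ∀ j k : Fin n, (j : ℕ) + 1 = (k : ℕ) → ∀ᶠ q in nhds p, q ≠ p → lam q j < lam q k := by
    intro j k hjk
    by_cases h : lam p j = lam p k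
    · exact cc_gap U hU lam L hL0 hL j k p (hcc.1 p hp j k hjk h)
    · have hlt : lam p j < lam p k := lt_of_le_of_ne (hmono p hp (by
        rw [Fin.le_def]; omega)) h
      have := (cc_cont U hU lam L hL p hp j).eventually_lt (cc_cont U hU lam L hL p hp k) hlt
      filter_upwards [this] with q hq _ using hq
  have h2 : ∀ᶠ q in nhds p, ∀ j k : Fin n, (j : ℕ) + 1 = (k : ℕ) → q ≠ p → lam q j < lam q k := by
    rw [Filter.eventually_all]; intro j
    rw [Filter.eventually_all]; intro k
    by_cases h : (j : ℕ) + 1 = (k : ℕ)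
    · filter_upwards [h1 j k h] with q hq _ using hq
    · exact Filter.Eventually.of_forall fun q h' => absurd h' h
  obtain ⟨r, hr, hb⟩ := Metric.eventually_nhds_iff_ball.1 (h2.and (hU.mem_nhds hp))
  refine ⟨r, hr, fun q hq => (hb q hq).2, fun q hq hne => ?_⟩
  have hstep := (hb q hq).1
  have hm := hmono q (hb q hq).2
  have : StrictMono (lam q) := by
    intro a b hab
    have hlt : (a : ℕ) + 1 < n + 0 := by have := b.2; have := Fin.lt_def.1 hab; omega
    have h3 := hstep a ⟨a + 1, hlt⟩ rfl hne
    exact h3.trans_le (hm (by rw [Fin.le_def]; exact Fin.lt_def.1 hab))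
  exact this.injective

theorem cc_punctured {m : ℕ} (hm : 2 ≤ m) (p : EuclideanSpace ℝ (Fin m)) (r : ℝ) :
    IsPreconnected (Metric.ball p r \ {p}) := by
  have h1 : IsPreconnected (Set.Ioo 0 r ×ˢ Metric.sphere (0 : EuclideanSpace ℝ (Fin m)) 1) := by
    refine isPreconnected_Ioo.prod (isPreconnected_sphere ?_ _ _)
    apply Module.one_lt_rank_of_one_lt_finrank
    simp; omega
  have h2 := h1.image (fun z : ℝ × EuclideanSpace ℝ (Fin m) => p + z.1 • z.2) (by fun_prop)
  convert h2 using 1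
  ext q
  constructor
  · rintro ⟨hq, hne⟩
    have hne : q ≠ p := hne
    have ht0 : 0 < ‖q - p‖ := norm_pos_iff.2 (sub_ne_zero.2 hne)
    refine ⟨(‖q - p‖, ‖q - p‖⁻¹ • (q - p)), ⟨⟨ht0, by simpa [dist_eq_norm] using hq⟩, ?_⟩, ?_⟩
    · simp [norm_smul, ht0.ne']
    · simp [smul_smul, ht0.ne']
  · rintro ⟨⟨t, v⟩, ⟨⟨ht0, htr⟩, hv⟩, rfl⟩
    have hv1 : ‖v‖ = 1 := by simpa using hv
    have ht0 : 0 < t := ht0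
    have htr : t < r := htr
    refine ⟨by simp [norm_smul, hv1, abs_of_pos ht0, htr], ?_⟩
    intro h
    have h' : p + t • v = p := h
    have : t • v = 0 := by simpa using h'
    have := congrArg norm this
    rw [norm_smul, hv1] at this
    simp at this
    exact ht0.ne' this

theorem cc_prop {m : ℕ} (hm : 2 ≤ m) (U : Set (EuclideanSpace ℝ (Fin m)))
    (hUc : IsConnected U) (f : EuclideanSpace ℝ (Fin m) → ℝ)
    (hf : ∀ p ∈ U, ContinuousAt f p)
    (hloc : ∀ p ∈ U, ∃ r > 0, AnalyticOnNhd ℝ f (Metric.ball p r \ {p}))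
    (h0 : ∃ p ∈ U, ∀ᶠ u in nhds p, f u = 0) : ∀ u ∈ U, f u = 0 := by
  have : Nonempty (Fin m) := ⟨⟨0, by omega⟩⟩
  let A : Set (EuclideanSpace ℝ (Fin m)) := {p | ∀ᶠ u in nhds p, f u = 0}
  have hA : IsOpen A := isOpen_setOfPred_eventually_nhds
  have key : U ⊆ A := by
    refine hUc.isPreconnected.subset_of_closure_inter_subset hA ?_ ?_
    · obtain ⟨p, hp, h⟩ := h0
      exact ⟨p, hp, h⟩
    rintro p ⟨hpA, hpU⟩
    obtain ⟨r, hr, han⟩ := hloc p hpU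
    have hmeet : (A ∩ (Metric.ball p r \ {p})).Nonempty := by
      obtain ⟨q, hqb, hqA⟩ := mem_closure_iff.1 hpA _ Metric.isOpen_ball (Metric.mem_ball_self hr)
      have hq : A ∩ Metric.ball p r ∈ nhds q := (hA.inter Metric.isOpen_ball).mem_nhds ⟨hqA, hqb⟩
      by_cases hqp : q = p
      · subst hqp
        obtain ⟨z, hz, hzne⟩ := Filter.nonempty_of_mem (Filter.inter_mem
          (nhdsWithin_le_nhds hq : _ ∈ nhdsWithin q {q}ᶜ) self_mem_nhdsWithin)
        exact ⟨z, hz.1, hz.2, hzne⟩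
      · exact ⟨q, hqA, hqb, hqp⟩
    obtain ⟨z, hzA, hzB⟩ := hmeet
    have hz := han.eqOn_zero_of_preconnected_of_eventuallyEq_zero (cc_punctured hm p r) hzB hzA
    have hne : ∀ᶠ u in nhdsWithin p {p}ᶜ, f u = 0 := by
      filter_upwards [nhdsWithin_le_nhds (Metric.ball_mem_nhds p hr), self_mem_nhdsWithin]
        with u hu hu' using hz ⟨hu, hu'⟩
    have hp0 : f p = 0 := by
      have h1 : Filter.Tendsto f (nhdsWithin p {p}ᶜ) (nhds (f p)) := (hf p hpU).mono_left nhdsWithin_le_nhds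
      have h2 : Filter.Tendsto f (nhdsWithin p {p}ᶜ) (nhds 0) :=
        tendsto_const_nhds.congr' (by filter_upwards [hne] with u hu using hu.symm)
      exact tendsto_nhds_unique h1 h2
    show ∀ᶠ u in nhds p, f u = 0
    filter_upwards [Metric.ball_mem_nhds p hr] with u hu
    by_cases hup : u = p
    · rw [hup, hp0]
    · exact hz ⟨hu, hup⟩
  intro u hu
  exact (key hu).self_of_nhds

theorem cc_trace {n m : ℕ} (U : Set (EuclideanSpace ℝ (Fin m)))
    (H0 : Matrix (Fin n) (Fin n) ℂ) (Hc : Fin m → Matrix (Fin n) (Fin n) ℂ)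
    (lam : EuclideanSpace ℝ (Fin m) → Fin n → ℝ)
    (hlam : IsOrderedSpectrum H0 Hc U lam) :
    ∀ u ∈ U, ∑ l, lam u l = H0.trace.re + ∑ i, u i * (Hc i).trace.re := by
  intro u hu
  have h := Matrix.trace_eq_sum_roots_charpoly (controlHam H0 Hc u)
  rw [(hlam u hu).2, Polynomial.roots_prod _ _ (by simp [Finset.prod_ne_zero_iff, Polynomial.X_sub_C_ne_zero])] at h
  have h2 : (controlHam H0 Hc u).trace = ((∑ l, lam u l : ℝ) : ℂ) := by
    rw [h]
    simp [List.sum_ofFn]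
  have h3 := congrArg Complex.re h2
  rw [Complex.ofReal_re] at h3
  rw [← h3]
  simp [controlHam, Matrix.trace_add, Matrix.trace_sum, Matrix.trace_smul]

theorem cc_coeff {n m : ℕ} (hm : 2 ≤ m) (U : Set (EuclideanSpace ℝ (Fin m))) (hU : IsOpen U)
    (H0 : Matrix (Fin n) (Fin n) ℂ) (Hc : Fin m → Matrix (Fin n) (Fin n) ℂ)
    (lam : EuclideanSpace ℝ (Fin m) → Fin n → ℝ)
    (hlam : IsOrderedSpectrum H0 Hc U lam)
    (hcont : ∀ p ∈ U, ∀ i, ContinuousAt (fun u => lam u i) p)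
    (c : Fin n → ℝ) (hc : ∀ u ∈ U, ∑ l, c l * lam u l = 0)
    (j k : Fin n) (hjk : (j : ℕ) + 1 = (k : ℕ)) (p : EuclideanSpace ℝ (Fin m))
    (hcon : ConicalAt U lam j k p) (hs : ∀ l : Fin n, l ≠ j → l ≠ k → SimpleEigAt lam p l) :
    c j = c k := by
  by_contra hne
  obtain ⟨hp, heq, -, d, hd, hv⟩ := hcon
  have hjk' : j ≠ k := by rintro rfl; omega
  have hjle : j ≤ k := by rw [Fin.le_def]; omega
  -- differentiability of the gap
  have hg : DifferentiableAt ℝ (fun u => lam u k - lam u j) p := by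
    let S : Finset (Fin n) := (Finset.univ.erase j).erase k
    have hS : ∀ u, ∀ b : Fin n → ℝ, ∑ l, b l * lam u l
        = b j * lam u j + (b k * lam u k + ∑ l ∈ S, b l * lam u l) := by
      intro u b
      rw [Finset.add_sum_erase _ (fun l => b l * lam u l) (by simp [hjk'.symm]),
        Finset.add_sum_erase _ (fun l => b l * lam u l) (by simp)]
    have hd1 : DifferentiableAt ℝ (fun u => (c k - c j)⁻¹ *
        (-(2 * ∑ l ∈ S, c l * lam u l) - (c j + c k) *
          ((H0.trace.re + ∑ i, u i * (Hc i).trace.re) - ∑ l ∈ S, lam u l))) p := by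
      have hl : ∀ l ∈ S, DifferentiableAt ℝ (fun u => lam u l) p := by
        intro l hl
        simp only [S, Finset.mem_erase] at hl
        exact (cc_analytic U hU H0 Hc lam hlam p hp l (hcont p hp l) (hs l hl.2.1 hl.1)).differentiableAt
      have e1 : DifferentiableAt ℝ (fun u => ∑ l ∈ S, c l * lam u l) p :=
        DifferentiableAt.fun_sum fun l h => (hl l h).const_mul _
      have e2 : DifferentiableAt ℝ (fun u => ∑ l ∈ S, lam u l) p :=
        DifferentiableAt.fun_sum fun l h => hl l h
      have e3 : DifferentiableAt ℝ (fun u : EuclideanSpace ℝ (Fin m) =>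
          (H0.trace.re + ∑ i, u i * (Hc i).trace.re)) p := by
        fun_prop
      fun_prop
    refine hd1.congr_of_eventuallyEq ?_
    filter_upwards [hU.mem_nhds hp] with u hu
    have h1 := hc u hu
    have h2 := cc_trace U H0 Hc lam hlam u hu
    have h3 := hS u c
    have h4 := hS u (fun _ => 1)
    simp only [one_mul] at h4
    have hne' : c k - c j ≠ 0 := sub_ne_zero.2 (Ne.symm hne)
    rw [← h2, h4]
    rw [h1] at h3
    rw [eq_inv_mul_iff_mul_eq₀ hne']
    linear_combination (-2) * h3
  obtain ⟨v, hv1⟩ : ∃ v : EuclideanSpace ℝ (Fin m), ‖v‖ = 1 :=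
    ⟨EuclideanSpace.single ⟨0, by omega⟩ 1, by simp⟩
  obtain ⟨ε, hε, hεt⟩ := hv v hv1
  have hmin : IsLocalMin (fun u => lam u k - lam u j) p := by
    filter_upwards [hU.mem_nhds hp] with u hu
    have := (hlam u hu).1 hjle
    rw [heq]; linarith
  have hz := hmin.hasFDerivAt_eq_zero hg.hasFDerivAt
  have hline : HasDerivAt (fun t : ℝ => p + t • v) v 0 := by
    have := ((hasDerivAt_id (0 : ℝ)).smul_const v).const_add p
    simpa using this
  have hg' : HasFDerivAt (fun u => lam u k - lam u j) (0 : EuclideanSpace ℝ (Fin m) →L[ℝ] ℝ)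
      (p + (0 : ℝ) • v) := by
    have := hg.hasFDerivAt
    rw [hz] at this
    simpa using this
  have hcomp := hg'.comp_hasDerivAt (0 : ℝ) hline
  have htend := hcomp.tendsto_slope_zero_right
  have : d ≤ (0 : EuclideanSpace ℝ (Fin m) →L[ℝ] ℝ) v := by
    refine ge_of_tendsto htend ?_
    filter_upwards [Ioo_mem_nhdsGT hε] with t ht
    have h1 := hεt t ht.1 ht.2
    have ht0 : 0 < t := ht.1
    simp only [zero_add, Function.comp, zero_smul, add_zero, heq, sub_self, sub_zero, smul_eq_mul]
    rw [inv_mul_eq_div, le_div_iff₀ ht0]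
    exact h1.le
  simp at this
  linarith

theorem cc_open {ι : Type*} {X : Type*} [TopologicalSpace X] (T : Finset ι)
    (f : ι → X → ℝ) (W : Set X) (hW : IsOpen W) (hne : W.Nonempty)
    (hf : ∀ i, ∀ p ∈ W, ContinuousAt (f i) p)
    (hz : ∀ i ∈ T, ∀ p ∈ W, ¬ ∀ᶠ u in nhds p, f i u = 0) :
    ∃ p ∈ W, ∀ i ∈ T, f i p ≠ 0 := by
  classical
  induction T using Finset.induction_on generalizing W with
  | empty => exact ⟨hne.some, hne.some_mem, by simp⟩
  | insert a s ha ih =>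
    obtain ⟨p, hp⟩ := hne
    have h1 : ∃ᶠ u in nhds p, f a u ≠ 0 := Filter.not_eventually.1 (hz a (by simp) p hp)
    obtain ⟨q, hq, hqW⟩ := (h1.and_eventually (hW.mem_nhds hp)).exists
    have h2 : ∀ᶠ u in nhds q, f a u ≠ 0 := (hf a q hqW).eventually_ne hq
    obtain ⟨V, hV, hVo, hqV⟩ := mem_nhds_iff.1 (h2.and (hW.mem_nhds hqW))
    obtain ⟨z, hzV, hzs⟩ := ih V hVo ⟨q, hqV⟩ (fun i p hp => hf i p (hV hp).2)
      (fun i hi p hp => hz i (by simp [hi]) p (hV hp).2)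
    refine ⟨z, (hV hzV).2, fun i hi => ?_⟩
    rcases Finset.mem_insert.1 hi with rfl | hi
    · exact (hV hzV).1
    · exact hzs i hi

/-- If the spectrum of the control-affine Hamiltonian `H(·)` is
conically connected, then there is `u0 ∈ U` at which all the eigenvalues are pairwise
distinct and all nonzero spectral gaps are pairwise distinct. -/
theorem conically_connected_exists_nonresonant_point {n m : ℕ} (hn : 2 ≤ n) (hm : 2 ≤ m)
    (U : Set (EuclideanSpace ℝ (Fin m))) (hUopen : IsOpen U) (hUconn : IsConnected U)
    (H0 : Matrix (Fin n) (Fin n) ℂ) (Hc : Fin m → Matrix (Fin n) (Fin n) ℂ)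
    (hH0 : H0.IsHermitian) (hHc : ∀ i, (Hc i).IsHermitian)
    (lam : EuclideanSpace ℝ (Fin m) → Fin n → ℝ)
    (hlam : IsOrderedSpectrum H0 Hc U lam)
    (hcc : ConicallyConnected U lam) :
    ∃ u0 ∈ U, Function.Injective (lam u0) ∧
      ∀ j k r s : Fin n, j ≠ k → r ≠ s → (j, k) ≠ (r, s) →
        lam u0 j - lam u0 k ≠ lam u0 r - lam u0 s := by
  obtain ⟨L, hL0, hL⟩ := cc_lip U H0 Hc hH0 hHc lam hlam
  have hcont := cc_cont U hUopen lam L hL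
  have hmono : ∀ u ∈ U, Monotone (lam u) := fun u hu => (hlam u hu).1
  have hiso := cc_isolated U hUopen lam L hL0 hL hmono hcc
  -- an open set of simple spectrum
  obtain ⟨p0, hp0⟩ := hUconn.nonempty
  obtain ⟨r0, hr0, hb0, hinj0⟩ := hiso p0 hp0
  let cf : Fin n × Fin n × Fin n × Fin n → Fin n → ℝ := fun q l =>
    (if q.1 = l then 1 else 0) - (if q.2.1 = l then 1 else 0) - (if q.2.2.1 = l then 1 else 0)
      + (if q.2.2.2 = l then 1 else 0)
  let f : Fin n × Fin n × Fin n × Fin n → EuclideanSpace ℝ (Fin m) → ℝ := fun q u =>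
    ∑ l, cf q l * lam u l
  have hfe : ∀ q u, f q u = lam u q.1 - lam u q.2.1 - lam u q.2.2.1 + lam u q.2.2.2 := by
    intro q u
    simp [f, cf, add_mul, sub_mul, Finset.sum_add_distrib, Finset.sum_sub_distrib]
  have hfc : ∀ q, ∀ p ∈ U, ContinuousAt (f q) p := by
    intro q p hp
    have h1 : f q = fun u => lam u q.1 - lam u q.2.1 - lam u q.2.2.1 + lam u q.2.2.2 :=
      funext (hfe q)
    rw [h1]
    exact (((hcont p hp _).sub (hcont p hp _)).sub (hcont p hp _)).add (hcont p hp _)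
  have hfa : ∀ q, ∀ p ∈ U, ∃ r > 0, AnalyticOnNhd ℝ (f q) (Metric.ball p r \ {p}) := by
    intro q p hp
    obtain ⟨r, hr, hb, hinj⟩ := hiso p hp
    refine ⟨r, hr, fun z hz => ?_⟩
    have hzU := hb hz.1
    have han : ∀ l, AnalyticAt ℝ (fun u => lam u l) z := fun l =>
      cc_analytic U hUopen H0 Hc lam hlam z hzU l (hcont z hzU l)
        (fun l' h' => hinj z hz.1 hz.2 h')
    have h1 : f q = fun u => lam u q.1 - lam u q.2.1 - lam u q.2.2.1 + lam u q.2.2.2 :=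
      funext (hfe q)
    rw [h1]
    exact (((han _).sub (han _)).sub (han _)).add (han _)
  let T : Finset (Fin n × Fin n × Fin n × Fin n) :=
    Finset.univ.filter fun q => q.1 ≠ q.2.1 ∧ q.2.2.1 ≠ q.2.2.2 ∧ (q.1, q.2.1) ≠ (q.2.2.1, q.2.2.2)
  have hT : ∀ q ∈ T, ∀ p ∈ U, ¬ ∀ᶠ u in nhds p, f q u = 0 := by
    intro q hq p hp hev
    have hzero := cc_prop hm U hUconn (f q) (hfc q) (hfa q) ⟨p, hp, hev⟩
    have hadj : ∀ j k : Fin n, (j : ℕ) + 1 = (k : ℕ) → cf q j = cf q k := by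
      intro j k hjk
      obtain ⟨ub, hcon, hs⟩ := hcc.2 j k hjk
      exact cc_coeff hm U hUopen H0 Hc lam hlam hcont (cf q) hzero j k hjk ub hcon hs
    have hall : ∀ N : ℕ, ∀ hN : N < n, cf q ⟨N, hN⟩ = cf q ⟨0, by omega⟩ := by
      intro N
      induction N with
      | zero => intro _; rfl
      | succ N ih =>
        intro hN
        rw [← ih (by omega)]
        exact (hadj ⟨N, by omega⟩ ⟨N + 1, hN⟩ rfl).symm
    have hall' : ∀ l, cf q l = cf q ⟨0, by omega⟩ := fun l => hall l l.2
    have hsum : ∑ l, cf q l = 0 := by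
      simp [cf, Finset.sum_add_distrib, Finset.sum_sub_distrib]
    have hc0 : cf q ⟨0, by omega⟩ = 0 := by
      rw [Finset.sum_congr rfl (fun l _ => hall' l)] at hsum
      simp only [Finset.sum_const, Finset.card_univ, Fintype.card_fin, nsmul_eq_mul, mul_eq_zero,
        Nat.cast_eq_zero] at hsum
      rcases hsum with h | h
      · omega
      · exact h
    obtain ⟨j, k, r, s⟩ := q
    simp only [T, Finset.mem_filter, Finset.mem_univ, true_and, ne_eq, Prod.mk.injEq] at hq
    obtain ⟨h1, h2, h3⟩ := hq
    have e1 : cf (j, k, r, s) j = 0 := (hall' j).trans hc0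
    have e2 : cf (j, k, r, s) k = 0 := (hall' k).trans hc0
    simp only [cf] at e1 e2
    rw [if_neg (Ne.symm h1)] at e1
    rw [if_neg h1] at e2
    by_cases hrj : r = j
    · by_cases hsk : s = k
      · exact h3 ⟨hrj.symm, hsk.symm⟩
      · rw [if_neg hsk] at e2
        split_ifs at e2 <;> norm_num at e2
    · rw [if_neg hrj] at e1
      split_ifs at e1 <;> norm_num at e1
  have : Nonempty (Fin m) := ⟨⟨0, by omega⟩⟩
  have hWo : IsOpen (Metric.ball p0 r0 \ {p0}) := Metric.isOpen_ball.sdiff isClosed_singleton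
  have hWn : (Metric.ball p0 r0 \ {p0}).Nonempty := by
    obtain ⟨z, hz, hz'⟩ := Filter.nonempty_of_mem (Filter.inter_mem
      (nhdsWithin_le_nhds (Metric.ball_mem_nhds p0 hr0) : _ ∈ nhdsWithin p0 {p0}ᶜ)
      self_mem_nhdsWithin)
    exact ⟨z, hz, hz'⟩
  obtain ⟨u0, hu0, hne⟩ := cc_open T f _ hWo hWn (fun q p hp => hfc q p (hb0 hp.1))
    (fun q hq p hp => hT q hq p (hb0 hp.1))
  refine ⟨u0, hb0 hu0.1, hinj0 u0 hu0.1 hu0.2, ?_⟩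
  intro j k r s h1 h2 h3 heq
  refine hne (j, k, r, s) (by simp only [T, Finset.mem_filter, Finset.mem_univ, true_and]; exact ⟨h1, h2, h3⟩) ?_
  rw [hfe]
  simp only
  linarith
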